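/- arXiv:2409.16238 — 2 statements merged into one kernel-verified Lean document; each statement's English description precedes it below -/
import Mathlib

section
/- Let r, r̂, and ε be real numbers with r ≥ 0, r̂ ≥ 0, 0 ≤ ε ≤ 1, and |r̂ - r| ≤ ε·r. Then (1 - ε)·ln(1 + r) ≤ ln(1 + r̂) ≤ ln(1 + r) + ln(1 + ε). -/
/-- If r ≥ 0, r̂ ≥ 0, 0 ≤ ε ≤ 1 and |r̂ - r| ≤ ε·r, then
(1 - ε)·ln(1 + r) ≤ ln(1 + r̂) ≤ ln(1 + r) + ln(1 + ε). -/
theorem log_recall_close (r rhat ε : ℝ) (hr : 0 ≤ r) (hrhat : 0 ≤ rhat)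
    (hε0 : 0 ≤ ε) (hε1 : ε ≤ 1) (h : |rhat - r| ≤ ε * r) :
    (1 - ε) * Real.log (1 + r) ≤ Real.log (1 + rhat) ∧
      Real.log (1 + rhat) ≤ Real.log (1 + r) + Real.log (1 + ε) := by
  obtain ⟨h1, h2⟩ := abs_le.mp h
  constructor
  · have hb := rpow_one_add_le_one_add_mul_self (s := r) (by linarith) (p := 1 - ε)
      (by linarith) (by linarith)
    rw [← Real.log_rpow (by linarith : (0 : ℝ) < 1 + r)]
    apply Real.log_le_log (Real.rpow_pos_of_pos (by linarith) _)
    linarith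
  · rw [← Real.log_mul (by linarith) (by linarith)]
    apply Real.log_le_log (by linarith)
    linarith
end

section
/- Let l and N be natural numbers, let d : ℕ → ℕ satisfy d(j) ≥ 1 for all j < l, and let n : ℕ → ℕ satisfy n(0) = N and n(j+1) = ⌈n(j)/d(j)⌉ (ceiling division of natural numbers) for all j. If N ≥ ∏_{j=0}^{l-1} d(j), then for every j < l it holds that n(j) ≥ ∏_{i=j}^{l-1} d(i); in particular, n(j) ≥ d(j) for every j < l. -/
/-- Budget recurrence: n(0) = N, n(j+1) = ⌈n(j)/d(j)⌉ (ceiling division on ℕ).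
If N ≥ ∏_{j<l} d(j) and d(j) ≥ 1 for all j < l, then n(j) ≥ ∏_{j ≤ i < l} d(i)
for every j < l; in particular n(j) ≥ d(j) for every j < l. -/
theorem budget_recurrence (l N : ℕ) (d n : ℕ → ℕ)
    (hd : ∀ j < l, 1 ≤ d j)
    (hn0 : n 0 = N)
    (hrec : ∀ j, n (j + 1) = n j ⌈/⌉ d j)
    (hN : ∏ j ∈ Finset.range l, d j ≤ N) :
    ∀ j < l, (∏ i ∈ Finset.Ico j l, d i) ≤ n j ∧ d j ≤ n j := by
  have key : ∀ j, j ≤ l → (∏ i ∈ Finset.Ico j l, d i) ≤ n j := by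
    intro j
    induction j with
    | zero =>
      intro _
      rw [hn0, ← Finset.range_eq_Ico]
      exact hN
    | succ k ih =>
      intro hk
      have hkl : k < l := hk
      have h := ih hkl.le
      rw [Finset.prod_eq_prod_Ico_succ_bot hkl] at h
      have hle : n k ≤ d k * (n k ⌈/⌉ d k) := by
        simpa using le_smul_ceilDiv (a := d k) (b := n k) (hd k hkl)
      rw [hrec]
      exact Nat.le_of_mul_le_mul_left (h.trans hle) (hd k hkl)
  intro j hj
  refine ⟨key j hj.le, ?_⟩
  have h := key j hj.le
  rw [Finset.prod_eq_prod_Ico_succ_bot hj] at h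
  have hpos : 0 < ∏ i ∈ Finset.Ico (j + 1) l, d i :=
    Finset.prod_pos fun i hi => hd i (Finset.mem_Ico.mp hi).2
  exact (Nat.le_mul_of_pos_right _ hpos).trans h
end
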